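/- Let F_q be a finite field with q elements, let ω ∈ F_q^*, and let m_1, …, m_t be pairwise distinct monomials in n variables whose exponents all lie in [0, D] with D < q − 1. Then the number of tuples (α_1, …, α_n) ∈ (F_q^*)^n for which there exist an index k ∈ {1, …, n} and indices i ≠ j with m_i(α_1, …, α_{k−1}, α_k ω, α_{k+1}, …, α_n) = m_j(α_1, …, α_{k−1}, α_k ω, α_{k+1}, …, α_n) is at most n·t(t−1)D(q−1)^{n−1}/2. -/

import Mathlib

open Polynomial in
/-- The equation `c x ^ a = d x ^ b` with `a ≠ b`, `a, b ≤ D` and `c, d` units of a field has at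
most `D` solutions among the units. -/
theorem card_units_mul_pow_eq_mul_pow_le {F : Type*} [Field F] (c d : Fˣ) {a b D : ℕ}
    (hab : a ≠ b) (ha : a ≤ D) (hb : b ≤ D) (s : Finset Fˣ)
    (hs : ∀ x ∈ s, x ^ a * c = x ^ b * d) : s.card ≤ D := by
  classical
  set p : F[X] := C (c : F) * X ^ a - C (d : F) * X ^ b with hp
  have hp0 : p ≠ 0 := by
    intro h
    have := congrArg (fun r : F[X] => r.coeff a) h
    simp [hp, coeff_X_pow, hab] at this
  have hdeg : p.natDegree ≤ D :=
    (natDegree_sub_le _ _).trans (max_le ((natDegree_C_mul_X_pow_le _ _).trans ha)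
      ((natDegree_C_mul_X_pow_le _ _).trans hb))
  calc s.card = (s.image (fun x : Fˣ => (x : F))).card :=
        (Finset.card_image_of_injective _ Units.val_injective).symm
    _ ≤ p.roots.toFinset.card := by
        refine Finset.card_le_card fun y hy => ?_
        obtain ⟨x, hx, rfl⟩ := Finset.mem_image.1 hy
        have h := congrArg (fun u : Fˣ => (u : F)) (hs x hx)
        simp only [Units.val_mul, Units.val_pow_eq_pow_val] at h
        rw [Multiset.mem_toFinset, mem_roots hp0]
        simp only [hp, IsRoot.def, eval_sub, eval_mul, eval_C, eval_pow, eval_X]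
        linear_combination h
    _ ≤ p.roots.card := Multiset.toFinset_card_le _
    _ ≤ D := (card_roots' p).trans hdeg

/-- Two distinct monomials with exponents at most `D` agree on at most `D (q - 1) ^ (n - 1)` points
of the torus `(Fˣ)ⁿ`. -/
theorem card_monomial_eq_le {F ι : Type*} [Field F] [Fintype Fˣ] [Fintype ι]
    {a b : ι → ℕ} {D : ℕ} (hab : a ≠ b) (ha : ∀ k, a k ≤ D) (hb : ∀ k, b k ≤ D)
    (s : Finset (ι → Fˣ)) (hs : ∀ β ∈ s, ∏ k, β k ^ a k = ∏ k, β k ^ b k) :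
    s.card ≤ D * Fintype.card Fˣ ^ (Fintype.card ι - 1) := by
  classical
  obtain ⟨l, hl⟩ := Function.ne_iff.1 hab
  have key := Finset.card_le_mul_card_image_of_maps_to (s := s)
    (t := (Finset.univ : Finset ({k // k ≠ l} → Fˣ))) (f := fun (β : ι → Fˣ) (k : {k // k ≠ l}) => β k)
    (fun _ _ => Finset.mem_univ _) D ?_
  · simpa [Fintype.card_subtype_compl] using key
  · intro γ _
    have hinj : Set.InjOn (fun β : ι → Fˣ => β l)
        (s.filter fun β => (fun k : {k // k ≠ l} => β k) = γ) := by
      intro β hβ β' hβ' h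
      have h1 := (Finset.mem_filter.1 hβ).2.trans (Finset.mem_filter.1 hβ').2.symm
      funext k
      by_cases hk : k = l
      · exact hk ▸ h
      · exact congrFun h1 ⟨k, hk⟩
    rw [← Finset.card_image_of_injOn hinj]
    refine card_units_mul_pow_eq_mul_pow_le (∏ k, γ k ^ a k) (∏ k, γ k ^ b k) hl (ha l) (hb l) _ ?_
    intro x hx
    obtain ⟨β, hβ, rfl⟩ := Finset.mem_image.1 hx
    obtain ⟨hβs, rfl⟩ := Finset.mem_filter.1 hβ
    have h := hs β hβs
    rwa [Fintype.prod_eq_mul_prod_subtype_ne _ l, Fintype.prod_eq_mul_prod_subtype_ne _ l] at h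

/-- With `ω ∈ Fˣ` and pairwise distinct monomials with exponents at most
`D < q - 1`, the number of tuples `α ∈ (Fˣ)ⁿ` for which there are `k` and `i ≠ j` with
`mᵢ(α₁, …, αₖω, …, αₙ) = mⱼ(α₁, …, αₖω, …, αₙ)` is at most `n·t(t-1)D(q-1)^{n-1}/2`. -/
theorem stmt4 (F : Type*) [Field F] [Fintype F] (q n D t : ℕ)
    (hq : Fintype.card F = q) (ω : Fˣ)
    (e : Fin t → Fin n → ℕ) (he : Function.Injective e)
    (hD : ∀ i k, e i k ≤ D) (hDq : D < q - 1) :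
    Nat.card {α : Fin n → Fˣ // ∃ (k0 : Fin n) (i j : Fin t), i ≠ j ∧
        (∏ k, (if k = k0 then α k * ω else α k) ^ e i k) =
          ∏ k, (if k = k0 then α k * ω else α k) ^ e j k} ≤
      n * (t * (t - 1) * D * (q - 1) ^ (n - 1) / 2) := by
  classical
  set M := D * (q - 1) ^ (n - 1) with hM
  let S : Fin n → Fin t → Fin t → Finset (Fin n → Fˣ) := fun k0 i j =>
    Finset.univ.filter fun α => (∏ k, (if k = k0 then α k * ω else α k) ^ e i k) =
          ∏ k, (if k = k0 then α k * ω else α k) ^ e j k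
  have hS : ∀ k0 i j, j < i → (S k0 i j).card ≤ M := by
    intro k0 i j hij
    have hinj : Function.Injective
        (fun (α : Fin n → Fˣ) k => if k = k0 then α k * ω else α k) := by
      intro α α' h
      funext k
      have hk := congrFun h k
      by_cases hk0 : k = k0 <;> simpa [hk0] using hk
    rw [← Finset.card_image_of_injective _ hinj]
    have := card_monomial_eq_le (he.ne hij.ne') (hD i) (hD j) ((S k0 i j).image
        (fun (α : Fin n → Fˣ) k => if k = k0 then α k * ω else α k)) (by
      intro β hβ
      obtain ⟨α, hα, rfl⟩ := Finset.mem_image.1 hβ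
      exact (Finset.mem_filter.1 hα).2)
    rwa [Fintype.card_units, hq, Fintype.card_fin] at this
  have hsub : (Finset.univ.filter fun α : Fin n → Fˣ => ∃ (k0 : Fin n) (i j : Fin t), i ≠ j ∧
        (∏ k, (if k = k0 then α k * ω else α k) ^ e i k) =
          ∏ k, (if k = k0 then α k * ω else α k) ^ e j k) ⊆
      Finset.univ.biUnion fun k0 => Finset.univ.biUnion fun i =>
        (Finset.Iio i).biUnion fun j => S k0 i j := by
    intro α hα
    obtain ⟨k0, i, j, hij, h⟩ := (Finset.mem_filter.1 hα).2
    simp only [Finset.mem_biUnion, Finset.mem_univ, true_and, Finset.mem_Iio, S,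
      Finset.mem_filter]
    rcases lt_or_gt_of_ne hij with hlt | hlt
    · exact ⟨k0, j, i, hlt, h.symm⟩
    · exact ⟨k0, i, j, hlt, h⟩
  have hpairs : t * (t - 1) * D * (q - 1) ^ (n - 1) / 2 = (∑ i : Fin t, (i : ℕ)) * M := by
    rw [Fin.sum_univ_eq_sum_range (fun i => i) t, mul_assoc, ← hM, ← Finset.sum_range_id_mul_two,
      mul_right_comm, Nat.mul_div_cancel _ two_pos]
  rw [Nat.card_eq_fintype_card, Fintype.card_subtype, hpairs]
  refine (Finset.card_le_card hsub).trans ?_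
  have hk : ∀ k0 ∈ (Finset.univ : Finset (Fin n)), (Finset.univ.biUnion fun i =>
      (Finset.Iio i).biUnion fun j => S k0 i j).card ≤ (∑ i : Fin t, (i : ℕ)) * M := by
    intro k0 _
    rw [Finset.sum_mul]
    refine Finset.card_biUnion_le.trans (Finset.sum_le_sum fun i _ => ?_)
    simpa using Finset.card_biUnion_le_card_mul (Finset.Iio i) (fun j => S k0 i j) M
      fun j hj => hS k0 i j (Finset.mem_Iio.1 hj)
  simpa using Finset.card_biUnion_le_card_mul _ _ _ hk
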